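/- Define E : ℍ → ℂ by E(z) := 1 − 24 ∑_{n≥1} σ₁(n) e^{2πinz} (the series converges absolutely for z ∈ ℍ). Let N ≥ 1 be an integer and k an even integer. Suppose f : ℍ → ℂ is holomorphic, nowhere vanishing on ℍ, and satisfies f(γ·z) = (cz + d)^k f(z) for every γ = [[a, b], [c, d]] ∈ SL₂(ℤ) with N ∣ c and every z ∈ ℍ. Define f_θ(z) := (1/(2πi)) · f′(z)/f(z) − (k/12) · E(z). Then for every such γ and every z ∈ ℍ, f_θ(γ·z) = (cz + d)² · f_θ(z). -/

import Mathlib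

/-- The `q`-expansion of the weight `2` Eisenstein series, indexed by `ℕ`. -/
theorem E2_eq_tsum_nat (z : UpperHalfPlane) :
    EisensteinSeries.E2 z = 1 - 24 * ∑' n : ℕ, (∑ d ∈ (n + 1).divisors, (d : ℂ)) *
      Complex.exp (2 * Real.pi * Complex.I * (n + 1) * z) := by
  rw [EisensteinSeries.E2_eq_tsum_cexp,
    tsum_pnat_eq_tsum_succ (f := fun n : ℕ ↦ (ArithmeticFunction.sigma 1 n : ℂ) *
      Complex.exp (2 * Real.pi * Complex.I * z) ^ n)]
  congr 2
  refine tsum_congr fun n ↦ ?_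
  rw [ArithmeticFunction.sigma_one_apply, ← Complex.exp_nat_mul]
  push_cast
  ring_nf

/-- The quasi-modular transformation law of the weight `2` Eisenstein series. -/
theorem E2_smul (γ : Matrix.SpecialLinearGroup (Fin 2) ℤ) (z : UpperHalfPlane) :
    EisensteinSeries.E2 (γ • z) =
      ((γ 1 0 : ℂ) * z + (γ 1 1 : ℂ)) ^ 2 * EisensteinSeries.E2 z +
        6 / (Real.pi * Complex.I) * (γ 1 0 : ℂ) * ((γ 1 0 : ℂ) * z + (γ 1 1 : ℂ)) := by
  have h := congrFun (EisensteinSeries.E2_slash_action γ) z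
  have hD : (γ 1 0 : ℂ) * z + (γ 1 1 : ℂ) ≠ 0 := by
    simpa [ModularGroup.denom_apply] using UpperHalfPlane.denom_ne_zero (γ : GL (Fin 2) ℝ) z
  rw [ModularForm.SL_slash_apply] at h
  simp only [EisensteinSeries.D2, Pi.sub_apply, Pi.smul_apply, smul_eq_mul,
    ModularGroup.denom_apply, riemannZeta_two, zpow_neg, zpow_ofNat] at h
  have hπ : (Real.pi : ℂ) ≠ 0 := by exact_mod_cast Real.pi_ne_zero
  rw [← div_eq_mul_inv, div_eq_iff (pow_ne_zero 2 hD)] at h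
  rw [h]
  field_simp
  linear_combination (-6 * (γ 1 0 : ℂ)) * Complex.I_sq

/-- A Möbius transformation with determinant `1` has derivative `(cz + d)⁻²`. -/
theorem hasDerivAt_moebius {a b c d z : ℂ} (hdet : a * d - b * c = 1) (hD : c * z + d ≠ 0) :
    HasDerivAt (fun w ↦ (a * w + b) / (c * w + d)) (1 / (c * z + d) ^ 2) z := by
  have h1 : HasDerivAt (fun w ↦ a * w + b) a z := by
    simpa using ((hasDerivAt_id z).const_mul a).add_const b
  have h2 : HasDerivAt (fun w ↦ c * w + d) c z := by
    simpa using ((hasDerivAt_id z).const_mul c).add_const d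
  refine (h1.div h2 hD).congr_deriv ?_
  rw [← hdet]
  ring

/-- The transformation law of the logarithmic derivative of a function satisfying a
weight `k` automorphy relation near a point. -/
theorem deriv_div_moebius {f : ℂ → ℂ} {a b c d z : ℂ} {k : ℤ}
    (hdet : a * d - b * c = 1) (hD : c * z + d ≠ 0) (hz : f z ≠ 0)
    (hfz : DifferentiableAt ℂ f z)
    (hfγ : DifferentiableAt ℂ f ((a * z + b) / (c * z + d)))
    (hmod : ∀ᶠ w in nhds z, f ((a * w + b) / (c * w + d)) = (c * w + d) ^ k * f w) :
    deriv f ((a * z + b) / (c * z + d)) / f ((a * z + b) / (c * z + d)) =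
      (c * z + d) ^ 2 * (deriv f z / f z) + k * c * (c * z + d) := by
  have hl := hfγ.hasDerivAt.comp z (hasDerivAt_moebius hdet hD)
  have h2 : HasDerivAt (fun w ↦ c * w + d) c z := by
    simpa using ((hasDerivAt_id z).const_mul c).add_const d
  have hr := ((hasDerivAt_zpow k _ (Or.inl hD)).comp z h2).mul hfz.hasDerivAt
  have h := hl.unique (hr.congr_of_eventuallyEq hmod)
  simp only [Function.comp_apply] at h
  have hk : (c * z + d) ^ k ≠ 0 := zpow_ne_zero k hD
  rw [hmod.self_of_nhds]
  rw [mul_one_div, div_eq_iff (pow_ne_zero 2 hD), zpow_sub_one₀ hD] at h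
  rw [h]
  field_simp
  ring


/-- If `f` is holomorphic, nonvanishing on `ℍ` and modular of even weight
`k` on `Γ₀(N)`, then `f_θ = (1/2πi)·f'/f - (k/12)·E₂` transforms as a modular form of
weight 2 on `Γ₀(N)`. -/
theorem stmt12 (E : ℂ → ℂ)
    (hE : ∀ z : ℂ, 0 < z.im →
      E z = 1 - 24 * ∑' n : ℕ, (∑ d ∈ (n + 1).divisors, (d : ℂ)) *
        Complex.exp (2 * Real.pi * Complex.I * (n + 1) * z))
    (N : ℕ) (hN : 1 ≤ N) (k : ℤ) (hk : Even k)
    (f : ℂ → ℂ)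
    (hf : DifferentiableOn ℂ f {z : ℂ | 0 < z.im})
    (hf0 : ∀ z : ℂ, 0 < z.im → f z ≠ 0)
    (hmod : ∀ γ : Matrix.SpecialLinearGroup (Fin 2) ℤ, (N : ℤ) ∣ γ 1 0 →
      ∀ z : ℂ, 0 < z.im →
        f (((γ 0 0 : ℂ) * z + (γ 0 1 : ℂ)) / ((γ 1 0 : ℂ) * z + (γ 1 1 : ℂ))) =
          ((γ 1 0 : ℂ) * z + (γ 1 1 : ℂ)) ^ k * f z)
    (fθ : ℂ → ℂ)
    (hfθ : ∀ z : ℂ, 0 < z.im →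
      fθ z = (1 / (2 * Real.pi * Complex.I)) * (deriv f z / f z) -
        ((k : ℂ) / 12) * E z) :
    ∀ γ : Matrix.SpecialLinearGroup (Fin 2) ℤ, (N : ℤ) ∣ γ 1 0 →
      ∀ z : ℂ, 0 < z.im →
        fθ (((γ 0 0 : ℂ) * z + (γ 0 1 : ℂ)) / ((γ 1 0 : ℂ) * z + (γ 1 1 : ℂ))) =
          ((γ 1 0 : ℂ) * z + (γ 1 1 : ℂ)) ^ 2 * fθ z := by
  intro γ hγ z hz
  let τ : UpperHalfPlane := ⟨z, hz⟩
  have hcoe : ((γ • τ : UpperHalfPlane) : ℂ) =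
      ((γ 0 0 : ℂ) * z + (γ 0 1 : ℂ)) / ((γ 1 0 : ℂ) * z + (γ 1 1 : ℂ)) := by
    rw [UpperHalfPlane.coe_specialLinearGroup_apply]
    simp [τ]
  have him := (γ • τ).im_pos
  rw [← UpperHalfPlane.coe_im, hcoe] at him
  have hD : (γ 1 0 : ℂ) * z + (γ 1 1 : ℂ) ≠ 0 := by
    have h := UpperHalfPlane.denom_ne_zero (γ : GL (Fin 2) ℝ) τ
    rwa [ModularGroup.denom_apply] at h
  have hdet : (γ 0 0 : ℂ) * γ 1 1 - (γ 0 1 : ℂ) * γ 1 0 = 1 := by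
    have h := γ.det_coe
    rw [Matrix.det_fin_two] at h
    exact_mod_cast h
  have hopen : IsOpen {z : ℂ | 0 < z.im} := isOpen_lt continuous_const Complex.continuous_im
  have hlog := deriv_div_moebius hdet hD (hf0 z hz) (hf.differentiableAt (hopen.mem_nhds hz))
    (hf.differentiableAt (hopen.mem_nhds him))
    (Filter.mem_of_superset (hopen.mem_nhds hz) fun w hw ↦ hmod γ hγ w hw)
  have hE2 : ∀ w : UpperHalfPlane, E w = EisensteinSeries.E2 w := fun w ↦ by
    rw [hE w w.im_pos, E2_eq_tsum_nat]
  have hEγ := E2_smul γ τ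
  rw [← hE2, ← hE2, hcoe, show (τ : ℂ) = z from rfl] at hEγ
  rw [hfθ _ him, hfθ z hz, hlog, hEγ]
  have hπ : (Real.pi : ℂ) ≠ 0 := by exact_mod_cast Real.pi_ne_zero
  field_simp
  ring
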